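/- arXiv:0812.3056 — 2 statements merged into one kernel-verified Lean document; each statement's English description precedes it below -/
import Mathlib

section
/- Let ι be a type and let V be a finite-dimensional ℂ(t)-subspace of the ℂ(t)-vector space of finitely supported functions from ι to ℂ(t). Then there exists a basis v_1,…,v_k of V such that every coordinate of every v_j lies in ℂ[t], and for every t_0 ∈ ℂ the family of coordinatewise evaluations (v_1(·)(t_0),…,v_k(·)(t_0)) is linearly independent over ℂ. -/
/-- View a finitely supported family of polynomials as a vector over the field of
rational functions `ℂ(t)`. -/
noncomputable def finsuppToRatFunc {ι : Type*} (u : ι →₀ Polynomial ℂ) : ι →₀ RatFunc ℂ :=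
  Finsupp.mapRange (algebraMap (Polynomial ℂ) (RatFunc ℂ)) (map_zero _) u

/-- Coordinatewise evaluation at `t0 : ℂ` of a finitely supported family of polynomials. -/
noncomputable def finsuppEvalAt {ι : Type*} (t0 : ℂ) (u : ι →₀ Polynomial ℂ) : ι →₀ ℂ :=
  Finsupp.mapRange (Polynomial.eval t0) (by simp) u

theorem Module.Basis.linearIndependent_coe {R M κ : Type*} [Ring R] [AddCommGroup M] [Module R M]
    {N : Submodule R M} (b : Module.Basis κ R N) : LinearIndependent R fun j => (b j : M) :=
  b.linearIndependent.map' _ N.ker_subtype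

section LatticeOfIntegralVectors

variable {ι R K : Type*} [CommRing R] [Field K] [Algebra R K]

variable (ι R K) in
/-- Coordinatewise inclusion of `ι →₀ R` into `ι →₀ K`. -/
noncomputable def Finsupp.mapAlgebra : (ι →₀ R) →ₗ[R] (ι →₀ K) :=
  Finsupp.mapRange.linearMap (Algebra.linearMap R K)

@[simp]
theorem Finsupp.mapAlgebra_apply (u : ι →₀ R) (i : ι) :
    Finsupp.mapAlgebra ι R K u i = algebraMap R K (u i) := rfl

theorem Finsupp.mapAlgebra_injective [FaithfulSMul R K] :
    Function.Injective (Finsupp.mapAlgebra ι R K) :=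
  Finsupp.mapRange_injective _ (map_zero _) (FaithfulSMul.algebraMap_injective R K)

/-- The finitely supported vectors over `R` that lie in a `K`-subspace of `ι →₀ K`. -/
noncomputable def Submodule.integralVectors (V : Submodule K (ι →₀ K)) : Submodule R (ι →₀ R) :=
  (V.restrictScalars R).comap (Finsupp.mapAlgebra ι R K)

theorem Submodule.mem_integralVectors {V : Submodule K (ι →₀ K)} {u : ι →₀ R} :
    u ∈ V.integralVectors ↔ Finsupp.mapAlgebra ι R K u ∈ V := Iff.rfl

theorem Submodule.mem_integralVectors_of_smul_mem [FaithfulSMul R K] {V : Submodule K (ι →₀ K)}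
    {a : R} (ha : a ≠ 0) {u : ι →₀ R} (hu : a • u ∈ V.integralVectors) :
    u ∈ V.integralVectors := by
  rw [mem_integralVectors, map_smul, ← algebraMap_smul K a] at hu
  exact (V.smul_mem_iff ((map_ne_zero_iff _ (FaithfulSMul.algebraMap_injective R K)).2 ha)).1 hu

theorem Finsupp.exists_smul_eq_mapAlgebra [IsDomain R] [IsFractionRing R K] (x : ι →₀ K) :
    ∃ a : R, a ≠ 0 ∧ ∃ u : ι →₀ R, a • x = Finsupp.mapAlgebra ι R K u := by
  obtain ⟨b, hb⟩ := IsLocalization.exist_integer_multiples (nonZeroDivisors R) x.support x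
  choose! f hf using hb
  refine ⟨b, nonZeroDivisors.coe_ne_zero b, Finsupp.onFinset x.support
    (Set.indicator x.support f) fun i hi => by simpa using Set.mem_of_indicator_ne_zero hi, ?_⟩
  ext i
  by_cases hi : i ∈ x.support
  · simp [Set.indicator_of_mem (show i ∈ (x.support : Set ι) from hi), hf i hi]
  · rw [Finsupp.mapAlgebra_apply, Finsupp.onFinset_apply,
      Set.indicator_of_notMem (by simpa using hi)]
    simp [Finsupp.notMem_support_iff.1 hi]

theorem Submodule.exists_finset_le_supported {V : Submodule K (ι →₀ K)} (hV : V.FG) :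
    ∃ S : Finset ι, V ≤ Finsupp.supported K K (S : Set ι) := by
  classical
  obtain ⟨s, rfl⟩ := hV
  refine ⟨s.biUnion Finsupp.support, Submodule.span_le.2 fun x hx => ?_⟩
  exact (Finsupp.mem_supported _ _).2 <| by
    exact_mod_cast Finset.subset_biUnion_of_mem Finsupp.support hx

theorem Submodule.exists_basis_integralVectors [IsDomain R] [IsPrincipalIdealRing R]
    [FaithfulSMul R K] {V : Submodule K (ι →₀ K)} (hV : V.FG) :
    ∃ k : ℕ, Nonempty (Module.Basis (Fin k) R (V.integralVectors : Submodule R (ι →₀ R))) := by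
  obtain ⟨S, hS⟩ := exists_finset_le_supported hV
  have hle : (V.integralVectors : Submodule R (ι →₀ R)) ≤ Finsupp.supported R R (S : Set ι) := by
    intro u hu
    have h := (Finsupp.mem_supported _ _).1 (hS (mem_integralVectors.1 hu))
    refine (Finsupp.mem_supported _ _).2 fun i hi => h ?_
    simpa [map_eq_zero_iff _ (FaithfulSMul.algebraMap_injective R K)] using hi
  let b : Module.Basis (S : Set ι) R (Finsupp.supported R R (S : Set ι)) :=
    .ofRepr (Finsupp.supportedEquivFinsupp (S : Set ι))
  exact ⟨_, ⟨(basisOfPidOfLE hle b).2⟩⟩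

theorem Submodule.linearIndependent_basis_integralVectors [IsDomain R] [IsFractionRing R K]
    {V : Submodule K (ι →₀ K)} {κ : Type*}
    (b : Module.Basis κ R (V.integralVectors : Submodule R (ι →₀ R))) :
    LinearIndependent K fun j => Finsupp.mapAlgebra ι R K (b j) := by
  have : FaithfulSMul R K := IsFractionRing.instFaithfulSMul R K
  rw [← LinearIndependent.iff_fractionRing (R := R)]
  exact b.linearIndependent_coe.map' (Finsupp.mapAlgebra ι R K)
    (LinearMap.ker_eq_bot.2 Finsupp.mapAlgebra_injective)

theorem Submodule.span_basis_integralVectors [IsDomain R] [IsFractionRing R K]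
    {V : Submodule K (ι →₀ K)} {κ : Type*}
    (b : Module.Basis κ R (V.integralVectors : Submodule R (ι →₀ R))) :
    span K (Set.range fun j => Finsupp.mapAlgebra ι R K (b j)) = V := by
  have : FaithfulSMul R K := IsFractionRing.instFaithfulSMul R K
  refine le_antisymm (span_le.2 ?_) fun x hx => ?_
  · rintro _ ⟨j, rfl⟩
    exact (b j).2
  obtain ⟨a, ha, u, hu⟩ := Finsupp.exists_smul_eq_mapAlgebra (R := R) x
  have hmem : u ∈ V.integralVectors := by
    rw [mem_integralVectors, ← hu, ← algebraMap_smul K a]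
    exact V.smul_mem _ hx
  rw [← smul_mem_iff _ ((map_ne_zero_iff _ (FaithfulSMul.algebraMap_injective R K)).2 ha),
    algebraMap_smul, hu]
  have key : ∀ w : (V.integralVectors : Submodule R (ι →₀ R)), Finsupp.mapAlgebra ι R K w ∈
      (span K (Set.range fun j => Finsupp.mapAlgebra ι R K (b j))).restrictScalars R := by
    intro w
    rw [← b.linearCombination_repr w, Finsupp.linearCombination_apply, Finsupp.sum]
    simp only [coe_sum, coe_smul, map_sum, map_smul]
    exact sum_mem fun j _ => smul_mem _ _ (subset_span ⟨j, rfl⟩)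
  exact key ⟨u, hmem⟩

end LatticeOfIntegralVectors

section Evaluation

open Polynomial

variable {ι : Type*}

theorem finsuppEvalAt_apply (t0 : ℂ) (u : ι →₀ ℂ[X]) (i : ι) :
    finsuppEvalAt t0 u i = (u i).eval t0 := rfl

theorem exists_eq_X_sub_C_smul_of_finsuppEvalAt_eq_zero {t0 : ℂ} {u : ι →₀ ℂ[X]}
    (hu : finsuppEvalAt t0 u = 0) : ∃ w : ι →₀ ℂ[X], u = (X - C t0) • w := by
  refine ⟨u.mapRange (· /ₘ (X - C t0)) (zero_divByMonic _), Finsupp.ext fun i => ?_⟩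
  exact (mul_divByMonic_eq_iff_isRoot.2 (DFunLike.congr_fun hu i)).symm

/-- A basis of a submodule of `ι →₀ ℂ[X]` that is saturated at `X - C t0` stays linearly
independent after evaluation at `t0`. -/
theorem linearIndependent_finsuppEvalAt_of_saturated {t0 : ℂ} {M : Submodule ℂ[X] (ι →₀ ℂ[X])}
    (hM : ∀ w, (X - C t0) • w ∈ M → w ∈ M) {κ : Type*} [Fintype κ] (b : Module.Basis κ ℂ[X] M) :
    LinearIndependent ℂ fun j => finsuppEvalAt t0 (b j : ι →₀ ℂ[X]) := by
  rw [Fintype.linearIndependent_iff]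
  intro c hc j
  set u : M := ∑ j, C (c j) • b j with hu
  have heval : finsuppEvalAt t0 (u : ι →₀ ℂ[X]) = 0 := by
    rw [← hc]
    ext i
    simp [hu, finsuppEvalAt_apply, Finsupp.finsetSum_apply, eval_finsetSum]
  obtain ⟨w, hw⟩ := exists_eq_X_sub_C_smul_of_finsuppEvalAt_eq_zero heval
  have huw : u = (X - C t0) • (⟨w, hM w (hw ▸ u.2)⟩ : M) := Subtype.ext hw
  have hrepr : C (c j) = (X - C t0) * b.repr ⟨w, hM w (hw ▸ u.2)⟩ j := by
    rw [← smul_eq_mul, ← Finsupp.smul_apply, ← map_smul, ← huw, hu, b.repr_sum_self]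
  simpa using congrArg (eval t0) hrepr

end Evaluation

/-- Every finite-dimensional subspace `V` of `ι →₀ ℂ(t)` has a basis
`v_1, …, v_k` all of whose coordinates are polynomials, and whose coordinatewise
evaluation at any `t0 : ℂ` is a linearly independent family over `ℂ`. -/
theorem exists_basis_specializing_everywhere {ι : Type}
    (V : Submodule (RatFunc ℂ) (ι →₀ RatFunc ℂ)) (hV : FiniteDimensional (RatFunc ℂ) V) :
    ∃ (k : ℕ) (v : Fin k → (ι →₀ Polynomial ℂ)),
      LinearIndependent (RatFunc ℂ) (fun j => finsuppToRatFunc (v j)) ∧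
      Submodule.span (RatFunc ℂ) (Set.range fun j => finsuppToRatFunc (v j)) = V ∧
      ∀ t0 : ℂ, LinearIndependent ℂ (fun j => finsuppEvalAt t0 (v j)) := by
  have hfg : V.FG := Module.Finite.iff_fg.1 hV
  obtain ⟨k, ⟨b⟩⟩ := Submodule.exists_basis_integralVectors (R := Polynomial ℂ) hfg
  exact ⟨k, fun j => b j, Submodule.linearIndependent_basis_integralVectors b,
    Submodule.span_basis_integralVectors b, fun t0 =>
      linearIndependent_finsuppEvalAt_of_saturated
        (fun _ hw => Submodule.mem_integralVectors_of_smul_mem (Polynomial.X_sub_C_ne_zero t0) hw) b⟩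
end

section
/- Take K = ℂ(q), the field of rational functions over ℂ, with q the indeterminate. For every n ≥ 1, if a polynomial p ∈ K[x_1,…,x_n] is q-harmonic and lies in the ideal of K[x_1,…,x_n] generated by the symmetric polynomials with zero constant term, then p = 0. That is, the classical hit polynomials and the q-harmonic polynomials are in direct sum. -/
open MvPolynomial

/-- The `q`-Steenrod operator `P_k` on `K[x_1,…,x_n]`:
`P_k(p) = ∑ i, x_i^k • (p + q • x_i • ∂p/∂x_i)`. -/
noncomputable def steenrodP (K : Type) [Field K] (q : K) (n k : ℕ) :
    Module.End K (MvPolynomial (Fin n) K) :=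
  ∑ i : Fin n, (LinearMap.mulLeft K (X i ^ k : MvPolynomial (Fin n) K)) ∘ₗ
    (LinearMap.id + q • ((LinearMap.mulLeft K (X i : MvPolynomial (Fin n) K)) ∘ₗ
      (pderiv i).toLinearMap))

/-- The dual `q`-Steenrod operator `P_k^*` on `K[x_1,…,x_n]`:
`P_k^*(p) = ∑ i, (∂^k p/∂x_i^k + q • x_i • ∂^{k+1} p/∂x_i^{k+1})`. -/
noncomputable def steenrodPdual (K : Type) [Field K] (q : K) (n k : ℕ) :
    Module.End K (MvPolynomial (Fin n) K) :=
  ∑ i : Fin n,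
    ((((pderiv i).toLinearMap : Module.End K (MvPolynomial (Fin n) K)) ^ k)
      + q • ((LinearMap.mulLeft K (X i : MvPolynomial (Fin n) K)) ∘ₗ
          ((((pderiv i).toLinearMap : Module.End K (MvPolynomial (Fin n) K)) ^ (k+1) : Module.End K (MvPolynomial (Fin n) K)) : MvPolynomial (Fin n) K →ₗ[K] MvPolynomial (Fin n) K)))

/-- The bilinear form `B(p,r) = ∑_m m! ⬝ p_m ⬝ r_m` over exponent vectors `m`. -/
noncomputable def formB {K : Type} [Field K] {n : ℕ} (p r : MvPolynomial (Fin n) K) : K :=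
  ∑ m ∈ p.support, (∏ i, ((m i).factorial : K)) * p.coeff m * r.coeff m

/-- `p` is `q`-harmonic if it is killed by all the dual `q`-Steenrod operators. -/
def IsQHarmonic {K : Type} [Field K] {n : ℕ} (q : K) (p : MvPolynomial (Fin n) K) : Prop :=
  ∀ k : ℕ, 1 ≤ k → steenrodPdual K q n k p = 0

/-- The space of `q`-hit polynomials: the span of the ranges of the `P_k`, `k ≥ 1`. -/
noncomputable def qHit (K : Type) [Field K] (q : K) (n : ℕ) :
    Submodule K (MvPolynomial (Fin n) K) :=
  Submodule.span K (⋃ k ∈ {k : ℕ | 1 ≤ k}, Set.range (steenrodP K q n k))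

/-- For a list `λ = [λ_1, …, λ_m]`, the operator `P_λ = P_{λ_1} ∘ ⋯ ∘ P_{λ_m}`. -/
noncomputable def steenrodPList (K : Type) [Field K] (q : K) (n : ℕ) (l : List ℕ) :
    Module.End K (MvPolynomial (Fin n) K) :=
  (l.map (steenrodP K q n)).prod

section ApolarForm

variable {σ R S : Type*} [Fintype σ] [CommRing R] [CommRing S]

/-- The apolar form `(r, p) ↦ ∑_m m! ⬝ p_m ⬝ r_m`, as a linear functional of `p`. -/
noncomputable def apolarForm (r : MvPolynomial σ R) : MvPolynomial σ R →ₗ[R] R :=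
  (basisMonomials σ R).constr R fun m => (∏ i, ((m i).factorial : R)) * r.coeff m

theorem apolarForm_monomial (r : MvPolynomial σ R) (m : σ →₀ ℕ) (c : R) :
    apolarForm r (monomial m c) = c * ((∏ i, ((m i).factorial : R)) * r.coeff m) := by
  have h : monomial m c = c • basisMonomials σ R m := by
    simp [coe_basisMonomials, smul_monomial]
  rw [h, map_smul, apolarForm, Module.Basis.constr_basis, smul_eq_mul]

theorem apolarForm_eq_sum (r p : MvPolynomial σ R) :
    apolarForm r p =
      ∑ m ∈ p.support, p.coeff m * ((∏ i, ((m i).factorial : R)) * r.coeff m) := by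
  conv_lhs => rw [p.as_sum]
  simp only [map_sum, apolarForm_monomial]

theorem map_apolarForm (f : R →+* S) (r p : MvPolynomial σ R) :
    f (apolarForm r p) = apolarForm (map f r) (map f p) := by
  induction p using MvPolynomial.induction_on' with
  | monomial m c => simp [apolarForm_monomial, map_monomial, coeff_map]
  | add p q hp hq => simp [hp, hq]

theorem apolarForm_sum_left {ι : Type*} (s : Finset ι) (r : ι → MvPolynomial σ R)
    (p : MvPolynomial σ R) :
    apolarForm (∑ i ∈ s, r i) p = ∑ i ∈ s, apolarForm (r i) p := by
  simp only [apolarForm_eq_sum, coeff_sum, Finset.mul_sum]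
  exact Finset.sum_comm

theorem apolarForm_mul_X (r p : MvPolynomial σ R) (i : σ) :
    apolarForm r (p * X i) = apolarForm (pderiv i r) p := by
  classical
  induction p using MvPolynomial.induction_on' with
  | monomial m c =>
    have h : ∏ j, (((m + Finsupp.single i 1 : σ →₀ ℕ) j).factorial : R) =
        (∏ j, ((m j).factorial : R)) * (m i + 1) := by
      rw [← Finset.mul_prod_erase _ _ (Finset.mem_univ i),
        ← Finset.mul_prod_erase _ (fun j => ((m j).factorial : R)) (Finset.mem_univ i)]
      have h' : ∏ j ∈ Finset.univ.erase i,
          (((m + Finsupp.single i 1 : σ →₀ ℕ) j).factorial : R) =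
          ∏ j ∈ Finset.univ.erase i, ((m j).factorial : R) :=
        Finset.prod_congr rfl fun j hj => by
          simp [Finsupp.single_eq_of_ne (Finset.ne_of_mem_erase hj)]
      rw [h']
      simp [Nat.factorial_succ]
      ring
    rw [X, monomial_mul, apolarForm_monomial, apolarForm_monomial, coeff_pderiv, h]
    ring
  | add p q hp hq => simp [add_mul, hp, hq]

theorem apolarForm_mul_X_pow (r p : MvPolynomial σ R) (i : σ) (k : ℕ) :
    apolarForm r (p * X i ^ k) = apolarForm ((pderiv i)^[k] r) p := by
  induction k generalizing r with
  | zero => simp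
  | succ k ih =>
    rw [pow_succ, ← mul_assoc, apolarForm_mul_X, ih, Function.iterate_succ_apply]

theorem apolarForm_mul_psum (r p : MvPolynomial σ R) (k : ℕ) :
    apolarForm r (p * psum σ R k) = apolarForm (∑ i, (pderiv i)^[k] r) p := by
  simp only [psum, Finset.mul_sum, map_sum, apolarForm_mul_X_pow, apolarForm_sum_left]

/-- A polynomial killed by all power sums of derivatives is apolar to the ideal generated by
the power sums. -/
theorem apolarForm_eq_zero_of_mem_span_psum {r p : MvPolynomial σ R}
    (hr : ∀ k : ℕ, 1 ≤ k → ∑ i, (pderiv i)^[k] r = 0)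
    (hp : p ∈ Ideal.span (Set.range fun k : ℕ => psum σ R (k + 1))) :
    apolarForm r p = 0 := by
  obtain ⟨c, rfl⟩ := Finsupp.mem_ideal_span_range_iff_exists_finsupp.mp hp
  refine (map_finsuppSum _ _ _).trans (Finset.sum_eq_zero fun k _ => ?_)
  simp only [apolarForm_mul_psum, hr _ (Nat.le_add_left 1 k)]
  simp [apolarForm_eq_sum]

end ApolarForm

section PowerSums

variable {K : Type*} [Field K] [CharZero K]

theorem esymm_mem_span_psum (σ : Type*) [Fintype σ] {k : ℕ} (hk : k ≠ 0) :
    esymm σ K k ∈ Ideal.span (Set.range fun k : ℕ => psum σ K (k + 1)) := by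
  have hmem : (k : MvPolynomial σ K) * esymm σ K k ∈
      Ideal.span (Set.range fun k : ℕ => psum σ K (k + 1)) := by
    rw [mul_esymm_eq_sum]
    refine Ideal.mul_mem_left _ _ (Ideal.sum_mem _ fun a ha => Ideal.mul_mem_left _ _ ?_)
    rw [Finset.mem_filter, Finset.HasAntidiagonal.mem_antidiagonal] at ha
    exact Ideal.subset_span ⟨a.2 - 1, by simp only [Nat.sub_add_cancel (by omega : 1 ≤ a.2)]⟩
  have h := Ideal.mul_mem_left _ (C (k : K)⁻¹) hmem
  rwa [← mul_assoc, ← map_natCast (C : K →+* MvPolynomial σ K), ← C_mul,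
    inv_mul_cancel₀ (Nat.cast_ne_zero.mpr hk), C_1, one_mul] at h

theorem mem_span_psum_of_isSymmetric {n : ℕ} {s : MvPolynomial (Fin n) K}
    (hs : s.IsSymmetric) (h0 : constantCoeff s = 0) :
    s ∈ Ideal.span (Set.range fun k : ℕ => psum (Fin n) K (k + 1)) := by
  set I := Ideal.span (Set.range fun k : ℕ => psum (Fin n) K (k + 1)) with hI
  have hconst : ∀ x ∈ I, constantCoeff x = 0 := by
    have : I ≤ RingHom.ker (constantCoeff (R := K) (σ := Fin n)) := by
      rw [hI, Ideal.span_le]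
      rintro _ ⟨k, rfl⟩
      simp [RingHom.mem_ker, psum]
    exact fun x hx => this hx
  have hsub : ∀ g : MvPolynomial (Fin n) K, ∃ c : K,
      (esymmAlgHom (Fin n) K n g : MvPolynomial (Fin n) K) - C c ∈ I := by
    intro g
    induction g using MvPolynomial.induction_on with
    | C a => exact ⟨a, by simp [esymmAlgHom, algebraMap_eq]⟩
    | add p q hp hq =>
      obtain ⟨c, hc⟩ := hp
      obtain ⟨d, hd⟩ := hq
      refine ⟨c + d, ?_⟩
      convert I.add_mem hc hd using 1
      simp
      ring
    | mul_X p i _ =>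
      refine ⟨0, ?_⟩
      have h : (esymmAlgHom (Fin n) K n (X i) : MvPolynomial (Fin n) K) =
          esymm (Fin n) K (i + 1) := by
        simp [esymmAlgHom]
      rw [map_mul, Subalgebra.coe_mul, h, C_0, sub_zero]
      exact I.mul_mem_left _ (esymm_mem_span_psum _ (Nat.succ_ne_zero _))
  obtain ⟨g, hg⟩ := (esymmAlgHom_fin_bijective K n).2 ⟨s, hs⟩
  obtain ⟨c, hc⟩ := hsub g
  rw [hg] at hc
  have h := hconst _ hc
  rw [map_sub, h0, constantCoeff_C, zero_sub, neg_eq_zero] at h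
  simpa [h] using hc

end PowerSums

section Specialization

variable {σ R S : Type*} [CommRing R] [CommRing S]

theorem map_iterate_pderiv (f : R →+* S) (i : σ) (k : ℕ) (p : MvPolynomial σ R) :
    map f ((pderiv i)^[k] p) = (pderiv i)^[k] (map f p) := by
  induction k generalizing p with
  | zero => rfl
  | succ k ih => rw [Function.iterate_succ_apply, ih, Function.iterate_succ_apply, pderiv_map]

theorem iterate_pderiv_C_mul (c : R) (i : σ) (k : ℕ) (p : MvPolynomial σ R) :
    (pderiv i)^[k] (C c * p) = C c * (pderiv i)^[k] p := by
  induction k generalizing p with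
  | zero => rfl
  | succ k ih => rw [Function.iterate_succ_apply, pderiv_C_mul, ih, Function.iterate_succ_apply]

variable [Fintype σ]

/-- The dual `q`-Steenrod operator over an arbitrary commutative ring of coefficients. -/
noncomputable def dualSteenrod (q : R) (k : ℕ) (p : MvPolynomial σ R) : MvPolynomial σ R :=
  ∑ i, ((pderiv i)^[k] p + C q * (X i * (pderiv i)^[k + 1] p))

theorem map_dualSteenrod (f : R →+* S) (q : R) (k : ℕ) (p : MvPolynomial σ R) :
    map f (dualSteenrod q k p) = dualSteenrod (f q) k (map f p) := by
  simp only [dualSteenrod, map_sum, map_add, map_mul, map_C, map_X, map_iterate_pderiv]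

theorem dualSteenrod_zero (k : ℕ) (p : MvPolynomial σ R) :
    dualSteenrod 0 k p = ∑ i, (pderiv i)^[k] p := by
  simp [dualSteenrod]

theorem dualSteenrod_C_mul (q c : R) (k : ℕ) (p : MvPolynomial σ R) :
    dualSteenrod q k (C c * p) = C c * dualSteenrod q k p := by
  simp only [dualSteenrod, iterate_pderiv_C_mul, Finset.mul_sum]
  exact Finset.sum_congr rfl fun i _ => by ring

theorem steenrodPdual_apply {K : Type} [Field K] (q : K) (n k : ℕ)
    (p : MvPolynomial (Fin n) K) : steenrodPdual K q n k p = dualSteenrod q k p := by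
  simp only [steenrodPdual, dualSteenrod, LinearMap.sum_apply, LinearMap.add_apply,
    LinearMap.smul_apply, LinearMap.comp_apply, Module.End.pow_apply, LinearMap.mulLeft_apply,
    smul_eq_C_mul]
  rfl

end Specialization

theorem eq_zero_of_apolarForm_conj_self {σ : Type*} [Fintype σ] {p : MvPolynomial σ ℂ}
    (h : apolarForm (map (starRingEnd ℂ) p) p = 0) : p = 0 := by
  have hsum : ∑ m ∈ p.support, (∏ i, ((m i).factorial : ℝ)) * Complex.normSq (p.coeff m) = 0 := by
    rw [apolarForm_eq_sum] at h
    rw [← Complex.ofReal_inj, Complex.ofReal_zero, ← h, Complex.ofReal_sum]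
    refine Finset.sum_congr rfl fun m _ => ?_
    rw [coeff_map, Complex.ofReal_mul, ← Complex.mul_conj]
    push_cast
    ring
  rw [Finset.sum_eq_zero_iff_of_nonneg fun m _ =>
    mul_nonneg (Finset.prod_nonneg fun i _ => Nat.cast_nonneg _) (Complex.normSq_nonneg _)] at hsum
  ext m
  by_contra hm
  have hne : ∏ i, ((m i).factorial : ℝ) ≠ 0 :=
    Finset.prod_ne_zero_iff.mpr fun i _ => Nat.cast_ne_zero.mpr (Nat.factorial_ne_zero _)
  have := hsum m (mem_support_iff.mpr hm)
  exact hm (by simpa [hne] using this)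

/-- The specialization at `q = 0` of a `q`-harmonic polynomial with coefficients in `ℂ[q]` which
is a classical hit over `ℂ(q)` vanishes. -/
theorem map_constantCoeff_eq_zero_of_harmonic_of_mem {n : ℕ}
    {P : MvPolynomial (Fin n) (Polynomial ℂ)}
    (hharm : ∀ k : ℕ, 1 ≤ k → dualSteenrod Polynomial.X k P = 0)
    (hhit : map (algebraMap (Polynomial ℂ) (RatFunc ℂ)) P ∈
      Ideal.span (Set.range fun k : ℕ => psum (Fin n) (RatFunc ℂ) (k + 1))) :
    map Polynomial.constantCoeff P = 0 := by
  set P₀ := map Polynomial.constantCoeff P with hP₀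
  have hP₀harm : ∀ k : ℕ, 1 ≤ k → dualSteenrod 0 k P₀ = 0 := fun k hk => by
    have h := map_dualSteenrod Polynomial.constantCoeff Polynomial.X k P
    rw [hharm k hk] at h
    simpa using h.symm
  set f := algebraMap (Polynomial ℂ) (RatFunc ℂ)
  set r := map (Polynomial.C.comp (starRingEnd ℂ)) P₀ with hr
  have hrharm : ∀ k : ℕ, 1 ≤ k → ∑ i, (pderiv i)^[k] (map f r) = 0 := fun k hk => by
    have h := map_dualSteenrod (f.comp (Polynomial.C.comp (starRingEnd ℂ))) 0 k P₀
    rw [hP₀harm k hk, map_zero, map_zero, dualSteenrod_zero, ← map_map] at h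
    exact h.symm
  have h0 : apolarForm r P = 0 := by
    apply RatFunc.algebraMap_injective ℂ
    rw [map_zero, map_apolarForm]
    exact apolarForm_eq_zero_of_mem_span_psum hrharm hhit
  apply eq_zero_of_apolarForm_conj_self
  have h := map_apolarForm Polynomial.constantCoeff r P
  rw [h0, map_zero, hr, map_map, ← hP₀] at h
  have hcomp : Polynomial.constantCoeff.comp (Polynomial.C.comp (starRingEnd ℂ)) =
      starRingEnd ℂ := by
    ext
    simp
  rw [hcomp] at h
  exact h.symm

theorem X_pow_dvd_coeff_of_harmonic_of_mem {n : ℕ} (N : ℕ)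
    {P : MvPolynomial (Fin n) (Polynomial ℂ)}
    (hharm : ∀ k : ℕ, 1 ≤ k → dualSteenrod Polynomial.X k P = 0)
    (hhit : map (algebraMap (Polynomial ℂ) (RatFunc ℂ)) P ∈
      Ideal.span (Set.range fun k : ℕ => psum (Fin n) (RatFunc ℂ) (k + 1)))
    (m : Fin n →₀ ℕ) : Polynomial.X ^ N ∣ P.coeff m := by
  induction N generalizing P with
  | zero => simp
  | succ N ih =>
    have h0 := map_constantCoeff_eq_zero_of_harmonic_of_mem hharm hhit
    have hdvd : C Polynomial.X ∣ P := by
      rw [C_dvd_iff_dvd_coeff]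
      intro m
      rw [Polynomial.X_dvd_iff]
      simpa [coeff_map] using congrArg (coeff m) h0
    obtain ⟨Q, rfl⟩ := hdvd
    rw [coeff_C_mul, pow_succ']
    refine mul_dvd_mul_left _ (ih (fun k hk => ?_) ?_)
    · have h := hharm k hk
      rw [dualSteenrod_C_mul] at h
      exact (mul_eq_zero.mp h).resolve_left (by simp)
    · rw [map_mul, map_C] at hhit
      have hX : algebraMap (Polynomial ℂ) (RatFunc ℂ) Polynomial.X ≠ 0 := by
        simp [RatFunc.X_ne_zero]
      have h := Ideal.mul_mem_left _ (C (algebraMap (Polynomial ℂ) (RatFunc ℂ) Polynomial.X)⁻¹) hhit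
      rwa [← mul_assoc, ← C_mul, inv_mul_cancel₀ hX, C_1, one_mul] at h

theorem exists_map_algebraMap_eq_C_mul {σ : Type*} (p : MvPolynomial σ (RatFunc ℂ)) :
    ∃ b : RatFunc ℂ, b ≠ 0 ∧ ∃ P : MvPolynomial σ (Polynomial ℂ),
      map (algebraMap (Polynomial ℂ) (RatFunc ℂ)) P = C b * p := by
  obtain ⟨b, hb⟩ := IsLocalization.exist_integer_multiples
    (nonZeroDivisors (Polynomial ℂ)) p.support fun m => p.coeff m
  refine ⟨algebraMap _ _ (b : Polynomial ℂ), by simp, ?_⟩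
  refine mem_range_map_iff_coeffs_subset.mpr fun c hc => ?_
  obtain ⟨m, hm, rfl⟩ := mem_coeffs_iff.mp hc
  have hmp : m ∈ p.support := by
    rw [mem_support_iff, coeff_C_mul] at hm
    exact mem_support_iff.mpr (right_ne_zero_of_mul hm)
  rw [coeff_C_mul, ← Algebra.smul_def]
  exact hb m hmp

/-- Over `K = ℂ(q)` with `q` the indeterminate, a `q`-harmonic
polynomial lying in the ideal generated by the symmetric polynomials with zero constant
term is zero: classical hits and `q`-harmonics are in direct sum. -/
theorem qHarmonic_inter_classicalHit_eq_bot (n : ℕ) (hn : 1 ≤ n)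
    (p : MvPolynomial (Fin n) (RatFunc ℂ))
    (hharm : IsQHarmonic (RatFunc.X) p)
    (hhit : p ∈ Ideal.span {s : MvPolynomial (Fin n) (RatFunc ℂ) |
        s.IsSymmetric ∧ constantCoeff s = 0}) :
    p = 0 := by
  obtain ⟨b, hb, P, hP⟩ := exists_map_algebraMap_eq_C_mul p
  have hinj : Function.Injective
      (map (algebraMap (Polynomial ℂ) (RatFunc ℂ)) : MvPolynomial (Fin n) _ →+* _) :=
    map_injective _ (RatFunc.algebraMap_injective ℂ)
  have hPhit : map (algebraMap (Polynomial ℂ) (RatFunc ℂ)) P ∈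
      Ideal.span (Set.range fun k : ℕ => psum (Fin n) (RatFunc ℂ) (k + 1)) := by
    rw [hP]
    refine Ideal.mul_mem_left _ _ (Ideal.span_le.mpr ?_ hhit)
    exact fun s hs => mem_span_psum_of_isSymmetric hs.1 hs.2
  have hPharm : ∀ k : ℕ, 1 ≤ k → dualSteenrod Polynomial.X k P = 0 := fun k hk => by
    apply hinj
    have h := hharm k hk
    rw [steenrodPdual_apply] at h
    rw [map_dualSteenrod, hP, dualSteenrod_C_mul, RatFunc.algebraMap_X, h, mul_zero, map_zero]
  have hP0 : P = 0 := by
    ext m d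
    exact Polynomial.X_pow_dvd_iff.mp
      (X_pow_dvd_coeff_of_harmonic_of_mem (d + 1) hPharm hPhit m) d d.lt_succ_self
  rw [hP0, map_zero] at hP
  exact (mul_eq_zero.mp hP.symm).resolve_left (by simpa using hb)
end
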